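/- Let T be a conformal Smale skew-product over the alphabet I = N* x N*. Then the Hausdorff dimension of the fiber limit set J_{T,omega} does not depend on omega: for all omega, omega' in Sigma_I^+, dim_H(J_{T,omega}) = dim_H(J_{T,omega'}). -/

import Mathlib

open MeasureTheory Filter Set Metric Topology

noncomputable section

/-- The left shift on one-sided sequences. -/
def shift1 {E : Type*} (ω : ℕ → E) : ℕ → E := fun n => ω (n + 1)

/-- The left shift on two-sided sequences. -/
def shift2 {E : Type*} (τ : ℤ → E) : ℤ → E := fun n => τ (n + 1)

/-- Truncation `π₀` of a two-sided sequence to its nonnegative coordinates. -/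
def truncZ {E : Type*} (τ : ℤ → E) : ℕ → E := fun n => τ (n : ℤ)

/-- Prepending a letter to a one-sided sequence. -/
def cons {E : Type*} (a : E) (ω : ℕ → E) : ℕ → E
  | 0 => a
  | n + 1 => ω n

/-- The cylinder `[τ₀ … τ_{n-1}]` in the two-sided shift space. -/
def cyl2 {E : Type*} (τ : ℤ → E) (n : ℕ) : Set (ℤ → E) :=
  {τ' | ∀ k : ℕ, k < n → τ' (k : ℤ) = τ (k : ℤ)}

/-- The cylinder `[ω]` of two-sided sequences agreeing with `ω` on all nonnegative
coordinates. -/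
def cylPlus {E : Type*} (ω : ℕ → E) : Set (ℤ → E) :=
  {τ | ∀ k : ℕ, τ (k : ℤ) = ω k}

/-- Birkhoff sums `S_n ψ` for the two-sided shift. -/
def birk {E : Type*} (ψ : (ℤ → E) → ℝ) (n : ℕ) (τ : ℤ → E) : ℝ :=
  ∑ j ∈ Finset.range n, ψ (shift2^[j] τ)

/-- `ψ` is Hölder continuous with respect to one of the metrics `d_β` on the two-sided
shift space. -/
def HolderShift {E : Type*} (ψ : (ℤ → E) → ℝ) : Prop :=
  ∃ β > (0 : ℝ), ∃ C > (0 : ℝ), ∀ (τ τ' : ℤ → E) (n : ℕ),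
    (∀ k : ℤ, |k| ≤ (n : ℤ) → τ k = τ' k) → |ψ τ - ψ τ'| ≤ C * Real.exp (-β * n)

/-- Summability of a potential on the two-sided shift space. -/
def SummablePot {E : Type*} (ψ : (ℤ → E) → ℝ) : Prop :=
  Summable fun e : E => Real.exp (sSup (ψ '' {τ : ℤ → E | τ 0 = e}))

/-- The sequence `(1/n) log Σ_{|w| = n} exp (sup S_n ψ |_{[w]})`, whose limit is the
topological pressure `P(ψ)`. -/
def pressureSeq {E : Type*} (ψ : (ℤ → E) → ℝ) (n : ℕ) : ℝ :=
  Real.log (∑' w : Fin n → E,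
    Real.exp (sSup (birk ψ n '' {τ : ℤ → E | ∀ j : Fin n, τ ((j : ℕ) : ℤ) = w j}))) / n

/-- `μ` is a Gibbs state of `ψ` with constant `P`. -/
def IsGibbs {E : Type*} [MeasurableSpace E] (ψ : (ℤ → E) → ℝ) (P : ℝ)
    (μ : Measure (ℤ → E)) : Prop :=
  ∃ C : ℝ, 1 ≤ C ∧ ∀ n : ℕ, 1 ≤ n → ∀ τ : ℤ → E,
    C⁻¹ * Real.exp (birk ψ n τ - n * P) ≤ (μ (cyl2 τ n)).toReal ∧
    (μ (cyl2 τ n)).toReal ≤ C * Real.exp (birk ψ n τ - n * P)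

/-- The shifted sequence `τ|_{-k}^∞`. -/
def tailShift {E : Type*} (τ : ℤ → E) (k : ℕ) : ℕ → E := fun m => τ ((m : ℤ) - (k : ℤ))

/-- The composition `T^n_τ = T_{τ|_{-1}^∞} ∘ ⋯ ∘ T_{τ|_{-n}^∞}`. -/
def Titer {E X : Type*} (T : (ℕ → E) → X → X) (τ : ℤ → E) : ℕ → X → X
  | 0 => id
  | n + 1 => Titer T τ n ∘ T (tailShift τ (n + 1))

/-- A conformal Smale skew-product endomorphism over the alphabet `E`:
fiberwise injective uniformly contracting conformal `C¹` maps of a compact set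
`Y ⊆ ℂ` (the closure of a bounded open set), extending to a bounded connected open
set `Y* ⊇ Y`, with bounded distortion, Hölder dependence of `log |T'|` along the
coding map `π̂₂`, the open set condition and the strong open set condition.
The coding map `π̂₂` (field `pi2`) is the map sending `τ` to the unique point of
`⋂_{n ≥ 1} closure (T^n_τ (Y))`. -/
structure SmaleSkew (E : Type*) [MeasurableSpace E] where
  Y : Set ℂ
  U : Set ℂ
  hUopen : IsOpen U
  hUbdd : Bornology.IsBounded U
  hUne : U.Nonempty
  hYU : Y = closure U
  Ystar : Set ℂ
  hYstar_open : IsOpen Ystar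
  hYstar_conn : IsConnected Ystar
  hYstar_bdd : Bornology.IsBounded Ystar
  hYYstar : Y ⊆ Ystar
  T : (ℕ → E) → ℂ → ℂ
  hTY : ∀ ω, MapsTo (T ω) Y Y
  hTYstar : ∀ ω, MapsTo (T ω) Ystar Ystar
  hTinj : ∀ ω, InjOn (T ω) Ystar
  hTdiff : ∀ ω, ∀ x ∈ Ystar, DifferentiableAt ℝ (T ω) x
  hTconf : ∀ ω, ∀ x ∈ Ystar, IsConformalMap (fderiv ℝ (T ω) x)
  hTC1 : ∀ ω, ContinuousOn (fun x => fderiv ℝ (T ω) x) Ystar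
  lam : ℝ
  hlam : 1 < lam
  hcontr : ∀ ω, ∀ y ∈ Ystar, ∀ z ∈ Ystar, dist (T ω y) (T ω z) ≤ lam⁻¹ * dist y z
  hdistortion : ∃ α > (0 : ℝ), ∃ H > (0 : ℝ), ∀ ω, ∀ y ∈ Ystar, ∀ z ∈ Ystar,
    |Real.log ‖fderiv ℝ (T ω) y‖ - Real.log ‖fderiv ℝ (T ω) z‖| ≤ H * ‖y - z‖ ^ α
  pi2 : (ℤ → E) → ℂ
  hpi2 : ∀ (τ : ℤ → E) (n : ℕ), 1 ≤ n → pi2 τ ∈ closure (Titer T τ n '' Y)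
  hpi2_meas : Measurable pi2
  hHolder : HolderShift fun τ => Real.log ‖fderiv ℝ (T (truncZ τ)) (pi2 τ)‖
  hOSC : ∀ (ω : ℕ → E) (a b : E), a ≠ b →
    (T (cons a ω) '' interior Y) ∩ (T (cons b ω) '' interior Y) = ∅
  hSOSC : ∃ δ : (ℕ → E) → ℝ, Measurable δ ∧ ∀ ω : ℕ → E, 0 < δ ω ∧
    ∃ x ∈ pi2 '' cylPlus ω, x ∈ Y ∧ δ ω < infDist x Yᶜ

/-- The fiber limit set `J_{T,ω} = π̂₂([ω])`. -/
def fiberJ {E : Type*} [MeasurableSpace E] (S : SmaleSkew E) (ω : ℕ → E) : Set ℂ :=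
  S.pi2 '' cylPlus ω

/-- The Lyapunov exponent `χ_T(μ) = -∫ log |T'_{η|₀^∞}(π̂₂ η)| dμ(η)`. -/
def lyap {E : Type*} [MeasurableSpace E] (S : SmaleSkew E) (μ : Measure (ℤ → E)) : ℝ :=
  -∫ τ, Real.log ‖fderiv ℝ (S.T (truncZ τ)) (S.pi2 τ)‖ ∂μ

/-- A measure `ν` on a metric space is exact dimensional with dimension `d` if
`log ν(B(x,r)) / log r → d` as `r → 0⁺`, for `ν`-a.e. `x`. -/
def ExactDimensional {X : Type*} [MetricSpace X] [MeasurableSpace X]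
    (ν : Measure X) (d : ℝ) : Prop :=
  ∀ᵐ x ∂ν, Tendsto (fun r : ℝ => Real.log (ν (ball x r)).toReal / Real.log r)
    (𝓝[>] (0 : ℝ)) (𝓝 d)

/-- The alphabet `I = ℕ* × ℕ*`. -/
abbrev Ialph : Type := ℕ+ × ℕ+

instance : MeasurableSpace ℕ+ := ⊤

instance : MeasurableSingletonClass ℕ+ := ⟨fun _ => MeasurableSpace.measurableSet_top⟩

/-- The geometric potential `ψ_{T,s}(η) = s log |T'_{η|₀^∞}(π̂₂ η)|`. -/
def geomPot {E : Type*} [MeasurableSpace E] (S : SmaleSkew E) (s : ℝ) :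
    (ℤ → E) → ℝ :=
  fun η => s * Real.log ‖fderiv ℝ (S.T (truncZ η)) (S.pi2 η)‖

/-- The interval `F(T)` of parameters `s ≥ 0` for which the geometric potential
`ψ_{T,s}` is summable. -/
def FT {E : Type*} [MeasurableSpace E] (S : SmaleSkew E) : Set ℝ :=
  {s : ℝ | 0 ≤ s ∧ Summable fun i : E =>
    sSup {x : ℝ | ∃ ω : ℕ → E, ∃ ξ ∈ fiberJ S (cons i ω),
      x = ‖fderiv ℝ (S.T (cons i ω)) ξ‖ ^ s}}


open scoped ENNReal NNReal

theorem IsConformalMap.norm_apply_eq {f : ℂ →L[ℝ] ℂ} (hf : IsConformalMap f) (x : ℂ) :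
    ‖f x‖ = ‖f‖ * ‖x‖ := by
  obtain ⟨c, -, li, rfl⟩ := hf
  have h : ∀ y, ‖(c • li.toContinuousLinearMap) y‖ = ‖c‖ * ‖y‖ := fun y => by
    simp
  have hc : ‖c • li.toContinuousLinearMap‖ = ‖c‖ := by
    refine ContinuousLinearMap.opNorm_eq_of_bounds (norm_nonneg c) (fun y => (h y).le) ?_
    intro N _ hb
    simpa [h] using hb 1
  rw [h, hc]

theorem IsConformalMap.norm_pos {f : ℂ →L[ℝ] ℂ} (hf : IsConformalMap f) : 0 < ‖f‖ :=
  _root_.norm_pos_iff.2 hf.ne_zero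

theorem IsConformalMap.norm_comp_eq {f g : ℂ →L[ℝ] ℂ} (hf : IsConformalMap f)
    (hg : IsConformalMap g) : ‖f.comp g‖ = ‖f‖ * ‖g‖ := by
  have h := (hf.comp hg).norm_apply_eq 1
  rw [ContinuousLinearMap.comp_apply, hf.norm_apply_eq, hg.norm_apply_eq] at h
  simpa using h.symm

theorem IsConformalMap.abs_det_eq {f : ℂ →L[ℝ] ℂ} (hf : IsConformalMap f) :
    |f.det| = ‖f‖ ^ 2 := by
  have hs : f '' closedBall 0 1 = closedBall 0 ‖f‖ := by
    have hinj : Function.Surjective f.toLinearMap :=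
      LinearMap.surjective_of_injective hf.injective
    ext y
    obtain ⟨x, rfl⟩ := hinj y
    have hx := hf.norm_apply_eq x
    simp only [ContinuousLinearMap.coe_coe, hf.injective.mem_set_image, mem_closedBall,
      dist_zero_right, hx]
    constructor
    · intro h
      exact mul_le_of_le_one_right (norm_nonneg _) h
    · intro h
      exact le_of_mul_le_mul_left (by simpa using h) hf.norm_pos
  have h := Measure.addHaar_image_continuousLinearMap volume f (closedBall 0 1)
  rw [hs, Complex.volume_closedBall, Complex.volume_closedBall, ← mul_assoc] at h
  have hpi : ((NNReal.pi : ℝ≥0∞)) ≠ 0 := by exact_mod_cast NNReal.pi_ne_zero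
  rw [ENNReal.mul_left_inj hpi ENNReal.coe_ne_top] at h
  simp only [ENNReal.ofReal_one, one_pow, mul_one] at h
  rw [← ENNReal.ofReal_pow (norm_nonneg _),
    ENNReal.ofReal_eq_ofReal_iff (by positivity) (abs_nonneg _)] at h
  exact h.symm

theorem IsConformalMap.exists_equiv {f : ℂ →L[ℝ] ℂ} (hf : IsConformalMap f) :
    ∃ e : ℂ ≃L[ℝ] ℂ, (e : ℂ →L[ℝ] ℂ) = f := by
  refine ⟨(LinearEquiv.ofInjectiveEndo f.toLinearMap hf.injective).toContinuousLinearEquiv, ?_⟩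
  ext x; simp

/-- Points of a compact subset of a connected open set are joined by chains of balls of bounded
length, so a derivative bound on the open set bounds the diameter of the image of the compact. -/
theorem exists_dist_le_of_norm_fderiv_le {U K : Set ℂ} (hU : IsOpen U) (hUc : IsPreconnected U)
    (hK : IsCompact K) (hKU : K ⊆ U) :
    ∃ C : ℝ, 0 < C ∧ ∀ (g : ℂ → ℂ) (A : ℝ), (∀ x ∈ U, DifferentiableAt ℝ g x) →
      (∀ x ∈ U, ‖fderiv ℝ g x‖ ≤ A) → ∀ y ∈ K, ∀ z ∈ K, dist (g y) (g z) ≤ C * A := by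
  have hball : ∀ x ∈ U, ∃ ε > 0, ∀ (g : ℂ → ℂ) (A : ℝ), (∀ x ∈ U, DifferentiableAt ℝ g x) →
      (∀ x ∈ U, ‖fderiv ℝ g x‖ ≤ A) → ∀ y ∈ ball x ε, dist (g x) (g y) ≤ ε * A := by
    intro x hx
    obtain ⟨ε, hε, hb⟩ := Metric.isOpen_iff.1 hU x hx
    refine ⟨ε, hε, fun g A hg hA y hy => ?_⟩
    have h := (convex_ball x ε).norm_image_sub_le_of_norm_fderiv_le (𝕜 := ℝ)
      (fun z hz => hg z (hb hz)) (fun z hz => hA z (hb hz)) hy (mem_ball_self hε)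
    rw [dist_eq_norm]
    refine h.trans ?_
    rw [mul_comm, ← dist_eq_norm, dist_comm]
    exact mul_le_mul_of_nonneg_right (le_of_lt hy) ((norm_nonneg _).trans (hA x hx))
  let P : ℂ → ℂ → Prop := fun x y => ∃ C : ℝ, ∀ (g : ℂ → ℂ) (A : ℝ),
    (∀ x ∈ U, DifferentiableAt ℝ g x) → (∀ x ∈ U, ‖fderiv ℝ g x‖ ≤ A) →
    dist (g x) (g y) ≤ C * A
  have hP : ∀ x ∈ U, ∀ y ∈ U, P x y := by
    intro x hx y hy
    refine hUc.induction₂' P ?_ ?_ hx hy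
    · intro x hx
      obtain ⟨ε, hε, hb⟩ := hball x hx
      filter_upwards [mem_nhdsWithin_of_mem_nhds (ball_mem_nhds x hε)] with y hy
      exact ⟨⟨ε, fun g A hg hA => hb g A hg hA y hy⟩,
        ⟨ε, fun g A hg hA => by rw [dist_comm]; exact hb g A hg hA y hy⟩⟩
    · rintro x y z - - - ⟨C₁, h₁⟩ ⟨C₂, h₂⟩
      refine ⟨C₁ + C₂, fun g A hg hA => (dist_triangle _ (g y) _).trans ?_⟩
      rw [add_mul]
      exact add_le_add (h₁ g A hg hA) (h₂ g A hg hA)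
  rcases K.eq_empty_or_nonempty with rfl | ⟨x₀, hx₀⟩
  · exact ⟨1, one_pos, by simp⟩
  have hcov : ∃ C : ℝ, ∀ y ∈ K, ∀ (g : ℂ → ℂ) (A : ℝ), (∀ x ∈ U, DifferentiableAt ℝ g x) →
      (∀ x ∈ U, ‖fderiv ℝ g x‖ ≤ A) → dist (g x₀) (g y) ≤ C * A := by
    refine hK.induction_on (p := fun s => ∃ C : ℝ, ∀ y ∈ s, ∀ (g : ℂ → ℂ) (A : ℝ),
      (∀ x ∈ U, DifferentiableAt ℝ g x) →
      (∀ x ∈ U, ‖fderiv ℝ g x‖ ≤ A) → dist (g x₀) (g y) ≤ C * A) ⟨0, by simp⟩ ?_ ?_ ?_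
    · rintro s t hst ⟨C, hC⟩
      exact ⟨C, fun y hy => hC y (hst hy)⟩
    · rintro s t ⟨C₁, h₁⟩ ⟨C₂, h₂⟩
      refine ⟨max C₁ C₂, fun y hy g A hg hA => ?_⟩
      have hA0 : 0 ≤ A := (norm_nonneg _).trans (hA x₀ (hKU hx₀))
      rcases hy with hy | hy
      · exact (h₁ y hy g A hg hA).trans (mul_le_mul_of_nonneg_right (le_max_left _ _) hA0)
      · exact (h₂ y hy g A hg hA).trans (mul_le_mul_of_nonneg_right (le_max_right _ _) hA0)
    · intro x hx
      obtain ⟨ε, hε, hb⟩ := hball x (hKU hx)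
      obtain ⟨C, hC⟩ := hP x₀ (hKU hx₀) x (hKU hx)
      refine ⟨ball x ε, mem_nhdsWithin_of_mem_nhds (ball_mem_nhds x hε), C + ε,
        fun y hy g A hg hA => (dist_triangle _ (g x) _).trans ?_⟩
      rw [add_mul]
      exact add_le_add (hC g A hg hA) (hb g A hg hA y hy)
  obtain ⟨C, hC⟩ := hcov
  refine ⟨2 * max C 1, by positivity, fun g A hg hA y hy z hz => ?_⟩
  have hA0 : 0 ≤ A := (norm_nonneg _).trans (hA x₀ (hKU hx₀))
  have h1 := hC y hy g A hg hA
  have h2 := hC z hz g A hg hA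
  have h3 := dist_triangle_left (g y) (g z) (g x₀)
  have h4 : C * A ≤ max C 1 * A := mul_le_mul_of_nonneg_right (le_max_left _ _) hA0
  linarith

/-- The first `k` letters of a sequence. -/
def seqPrefix {F : Type*} (ξ : ℕ → F) (k : ℕ) : Fin k → F := fun i => ξ i

theorem infinitePi_seqPrefix {F : Type*} [MeasurableSpace F] [DiscreteMeasurableSpace F]
    (ρ : Measure F) [IsProbabilityMeasure ρ] (k : ℕ) (w : Fin k → F) :
    Measure.infinitePi (fun _ : ℕ => ρ) {ξ | seqPrefix ξ k = w} = ∏ i, ρ {w i} := by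
  have h : {ξ : ℕ → F | seqPrefix ξ k = w} =
      Set.pi (Finset.range k) (fun i => if h : i < k then {w ⟨i, h⟩} else univ) := by
    ext ξ
    simp only [seqPrefix, funext_iff, mem_ofPred_eq, Set.mem_pi, Finset.coe_range, mem_Iio]
    constructor
    · intro h i hi
      simpa [hi] using h ⟨i, hi⟩
    · intro h i
      simpa using h i i.2
  rw [h, Measure.infinitePi_pi _ (fun i _ => MeasurableSet.of_discrete), Finset.prod_range]
  simp

/-- A measure satisfying a power law on small closed sets is a lower bound for the dimension. -/
theorem le_dimH_of_measure_le {X : Type*} [MetricSpace X] [MeasurableSpace X] [BorelSpace X]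
    (μ : Measure X) {J : Set X} (hJ : μ J ≠ 0) {t : ℝ≥0} (ht : 0 < t) {D : ℝ} (hD : 0 < D)
    (h : ∀ (A : Set X) (r : ℝ), IsClosed A → 0 < r → r < 1 → (∀ x ∈ A, ∀ y ∈ A, dist x y ≤ r) →
      μ A ≤ ENNReal.ofReal (D * r ^ (t : ℝ))) : t ≤ dimH J := by
  have ht' : (0 : ℝ) < t := ht
  have hD0 : ENNReal.ofReal D ≠ 0 := by simpa using hD
  have key : ∀ s : Set X, ediam s ≤ 2⁻¹ → μ s ≤ ENNReal.ofReal D * ediam s ^ (t : ℝ) := by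
    intro s hs
    have hfin : ediam s ≠ ⊤ := ne_top_of_le_ne_top (by simp) hs
    have hdist : ∀ r, ediam s ≤ ENNReal.ofReal r → 0 < r →
        ∀ x ∈ closure s, ∀ y ∈ closure s, dist x y ≤ r := by
      intro r hr hr0 x hx y hy
      have := (edist_le_ediam_of_mem hx hy).trans ((ediam_closure s).le.trans hr)
      rwa [edist_dist, ENNReal.ofReal_le_ofReal_iff hr0.le] at this
    rcases eq_or_ne (ediam s) 0 with h0 | h0
    · have hlim : Tendsto (fun r : ℝ => ENNReal.ofReal (D * r ^ (t : ℝ))) (𝓝[>] 0) (𝓝 0) := by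
        have h1 : Tendsto (fun r : ℝ => D * r ^ (t : ℝ)) (𝓝[>] 0) (𝓝 (D * 0 ^ (t : ℝ))) :=
          (((Real.continuousAt_rpow_const 0 t (Or.inr ht'.le)).tendsto).const_mul D).mono_left
            nhdsWithin_le_nhds
        rw [Real.zero_rpow ht'.ne', mul_zero] at h1
        simpa using ENNReal.tendsto_ofReal h1
      have hle : μ s ≤ 0 := by
        refine ge_of_tendsto hlim ?_
        filter_upwards [Ioo_mem_nhdsGT (zero_lt_one' ℝ)] with r hr
        exact (measure_mono subset_closure).trans (h _ r isClosed_closure hr.1 hr.2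
          (hdist r (by simp [h0]) hr.1))
      exact hle.trans zero_le
    · set r := (ediam s).toReal with hr
      have hr0 : 0 < r := ENNReal.toReal_pos h0 hfin
      have hsr : ediam s = ENNReal.ofReal r := (ENNReal.ofReal_toReal hfin).symm
      have hr1 : r < 1 := by
        have : r ≤ (2⁻¹ : ℝ≥0∞).toReal := ENNReal.toReal_mono (by simp) hs
        simp at this
        linarith
      refine (measure_mono subset_closure).trans
        ((h _ r isClosed_closure hr0 hr1 (hdist r hsr.le hr0)).trans ?_)
      rw [ENNReal.ofReal_mul hD.le, hsr, ENNReal.ofReal_rpow_of_pos hr0]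
  have hle : (ENNReal.ofReal D)⁻¹ • μ ≤ μH[t] := by
    refine Measure.le_hausdorffMeasure _ _ 2⁻¹ (by simp) fun s hs => ?_
    rw [Measure.smul_apply, smul_eq_mul, mul_comm, ← div_eq_mul_inv]
    exact ENNReal.div_le_of_le_mul' (key s hs)
  refine le_dimH_of_hausdorffMeasure_ne_zero fun h0 => ?_
  have := hle J
  rw [h0, Measure.smul_apply, smul_eq_mul, nonpos_iff_eq_zero, mul_eq_zero] at this
  exact this.elim (by simp) hJ

/-- Lower bound for the dimension of a planar Moran-type limit set whose pieces of size `a`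
contain pairwise disjoint sets of area comparable to `a ^ 2`. -/
theorem le_dimH_range_of_moran {F : Type*} [Fintype F] [MeasurableSpace F]
    [DiscreteMeasurableSpace F] {f : (ℕ → F) → ℂ} (hf : Measurable f)
    {p : F → ℝ} (hp0 : ∀ i, 0 ≤ p i) (hp1 : ∑ i, p i = 1) {t : ℝ≥0} (ht : 0 < t)
    {a : ∀ k, (Fin k → F) → ℝ} (ha : ∀ k w, 0 < a k w) (ha0 : ∀ w, a 0 w = 1)
    (hlim : ∀ ξ r, 0 < r → ∃ k, a k (seqPrefix ξ k) ≤ r) {c : ℝ} (hc : 0 < c)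
    (hstep : ∀ ξ k, c * a k (seqPrefix ξ k) ≤ a (k + 1) (seqPrefix ξ (k + 1)))
    (hpa : ∀ k w, ∏ i, p (w i) ≤ a k w ^ (t : ℝ))
    {V : ∀ k, (Fin k → F) → Set ℂ} (hVm : ∀ k w, MeasurableSet (V k w))
    (hvol : ∀ k w, ENNReal.ofReal (c * a k w ^ 2) ≤ volume (V k w)) {C : ℝ} (hC : 0 ≤ C)
    (hV : ∀ ξ k, V k (seqPrefix ξ k) ⊆ closedBall (f ξ) (C * a k (seqPrefix ξ k)))
    (hdisj : ∀ (ξ η : ℕ → F) (k l i : ℕ), i < k → i < l → ξ i ≠ η i →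
      Disjoint (V k (seqPrefix ξ k)) (V l (seqPrefix η l))) :
    t ≤ dimH (range f) := by
  classical
  let ρ : Measure F := ∑ i, ENNReal.ofReal (p i) • Measure.dirac i
  have hρ : ∀ i, ρ {i} = ENNReal.ofReal (p i) := by
    intro i
    simp only [ρ, Measure.coe_finsetSum, Measure.coe_smul, Finset.sum_apply, Pi.smul_apply,
      smul_eq_mul]
    rw [Finset.sum_eq_single i]
    · simp
    · intro j _ hj
      simp [hj]
    · simp
  have : IsProbabilityMeasure ρ := ⟨by
    simp only [ρ, Measure.coe_finsetSum, Measure.coe_smul, Finset.sum_apply, Pi.smul_apply,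
      smul_eq_mul, measure_univ, mul_one]
    rw [← ENNReal.ofReal_sum_of_nonneg fun i _ => hp0 i, hp1, ENNReal.ofReal_one]⟩
  let ν := Measure.infinitePi (fun _ : ℕ => ρ)
  have hν : ∀ k w, ν {ξ | seqPrefix ξ k = w} ≤ ENNReal.ofReal (a k w ^ (t : ℝ)) := by
    intro k w
    simp only [ν]
    rw [infinitePi_seqPrefix]
    simp only [hρ]
    rw [← ENNReal.ofReal_prod_of_nonneg fun i _ => hp0 _]
    exact ENNReal.ofReal_le_ofReal (hpa k w)
  have hD : 0 < (1 + C) ^ 2 * Real.pi / c ^ 3 := by positivity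
  refine le_dimH_of_measure_le (ν.map f) ?_ ht hD ?_
  · have h1 := Measure.le_map_apply (μ := ν) hf.aemeasurable (range f)
    rw [preimage_range, measure_univ] at h1
    exact (one_pos.trans_le h1).ne'
  intro A r hA hr0 hr1 hAr
  rw [Measure.map_apply hf hA.measurableSet]
  rcases (f ⁻¹' A).eq_empty_or_nonempty with he | ⟨η₀, hη₀⟩
  · simp [he]
  let n : (ℕ → F) → ℕ := fun ξ => Nat.find (hlim ξ r hr0)
  have hn : ∀ ξ, a (n ξ) (seqPrefix ξ (n ξ)) ≤ r := fun ξ => Nat.find_spec (hlim ξ r hr0)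
  have hn' : ∀ ξ k, k < n ξ → r < a k (seqPrefix ξ k) := fun ξ k hk =>
    not_le.1 (Nat.find_min (hlim ξ r hr0) hk)
  have hlow : ∀ ξ, c * r ≤ a (n ξ) (seqPrefix ξ (n ξ)) := by
    intro ξ
    obtain ⟨m, hm⟩ : ∃ m, n ξ = m + 1 := by
      refine Nat.exists_eq_succ_of_ne_zero fun h0 => ?_
      have := hn ξ
      rw [h0, ha0] at this
      linarith
    rw [hm]
    exact (mul_le_mul_of_nonneg_left (hn' ξ m (by omega)).le hc.le).trans (hstep ξ m)
  let W : Set (Σ k, Fin k → F) := (fun ξ => ⟨n ξ, seqPrefix ξ (n ξ)⟩) '' (f ⁻¹' A)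
  have hcov : f ⁻¹' A ⊆ ⋃ s : W, {ξ | seqPrefix ξ s.1.1 = s.1.2} := by
    intro ξ hξ
    exact mem_iUnion.2 ⟨⟨_, mem_image_of_mem _ hξ⟩, rfl⟩
  have hdis : Pairwise (Function.onFun Disjoint fun s : W => V s.1.1 s.1.2) := by
    rintro ⟨_, ξ, hξ, rfl⟩ ⟨_, η, hη, rfl⟩ hne
    by_cases hex : ∃ i, i < n ξ ∧ i < n η ∧ ξ i ≠ η i
    · obtain ⟨i, h1, h2, h3⟩ := hex
      exact hdisj ξ η _ _ i h1 h2 h3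
    · exfalso
      push Not at hex
      apply hne
      have heq : ∀ k, k ≤ n ξ → k ≤ n η → seqPrefix ξ k = seqPrefix η k := fun k h1 h2 =>
        funext fun i => hex i (i.2.trans_le h1) (i.2.trans_le h2)
      have hnn : n ξ = n η := by
        rcases lt_trichotomy (n ξ) (n η) with h | h | h
        · have h1 := hn' η _ h
          rw [← heq _ le_rfl h.le] at h1
          exact absurd (hn ξ) (not_le.2 h1)
        · exact h
        · have h1 := hn' ξ _ h
          rw [heq _ h.le le_rfl] at h1
          exact absurd (hn η) (not_le.2 h1)
      have h2 := heq (n ξ) le_rfl hnn.le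
      refine Subtype.ext ?_
      change (⟨n ξ, seqPrefix ξ (n ξ)⟩ : Σ k, Fin k → F) = ⟨n η, seqPrefix η (n η)⟩
      rw [h2, hnn]
  have hκ : (0 : ℝ) ≤ r ^ (t : ℝ) / (c * (c * r) ^ 2) := by positivity
  have hmass : ∀ s : W, ν {ξ | seqPrefix ξ s.1.1 = s.1.2} ≤
      ENNReal.ofReal (r ^ (t : ℝ) / (c * (c * r) ^ 2)) * volume (V s.1.1 s.1.2) := by
    rintro ⟨_, ξ, hξ, rfl⟩
    refine (hν _ _).trans (le_trans ?_ (mul_le_mul_right (hvol _ _) _))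
    rw [← ENNReal.ofReal_mul hκ]
    refine ENNReal.ofReal_le_ofReal ?_
    refine (Real.rpow_le_rpow (ha _ _).le (hn ξ) t.2).trans ?_
    have h1 : c * (c * r) ^ 2 ≤ c * a (n ξ) (seqPrefix ξ (n ξ)) ^ 2 := by
      gcongr
      exact hlow ξ
    rw [div_mul_eq_mul_div, le_div_iff₀ (by positivity)]
    exact mul_le_mul_of_nonneg_left h1 (by positivity)
  have hsub : (⋃ s : W, V s.1.1 s.1.2) ⊆ closedBall (f η₀) ((1 + C) * r) := by
    refine iUnion_subset ?_
    rintro ⟨_, ξ, hξ, rfl⟩ x hx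
    have h1 := mem_closedBall.1 (hV ξ _ hx)
    have h2 := hAr _ hξ _ hη₀
    have h3 := mul_le_mul_of_nonneg_left (hn ξ) hC
    rw [mem_closedBall]
    have h4 := dist_triangle x (f ξ) (f η₀)
    linarith
  calc ν (f ⁻¹' A) ≤ ∑' s : W, ν {ξ | seqPrefix ξ s.1.1 = s.1.2} :=
        (measure_mono hcov).trans (measure_iUnion_le _)
    _ ≤ ∑' s : W, ENNReal.ofReal (r ^ (t : ℝ) / (c * (c * r) ^ 2)) * volume (V s.1.1 s.1.2) :=
        ENNReal.tsum_le_tsum hmass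
    _ = ENNReal.ofReal (r ^ (t : ℝ) / (c * (c * r) ^ 2)) * volume (⋃ s : W, V s.1.1 s.1.2) := by
        rw [ENNReal.tsum_mul_left, measure_iUnion hdis fun s => hVm _ _]
    _ ≤ ENNReal.ofReal (r ^ (t : ℝ) / (c * (c * r) ^ 2)) *
          volume (closedBall (f η₀) ((1 + C) * r)) := by gcongr
    _ = ENNReal.ofReal ((1 + C) ^ 2 * Real.pi / c ^ 3 * r ^ (t : ℝ)) := by
        have hpi : ((NNReal.pi : ℝ≥0∞)) = ENNReal.ofReal Real.pi := by
          rw [← NNReal.coe_real_pi, ENNReal.ofReal_coe_nnreal]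
        rw [Complex.volume_closedBall, hpi, ← ENNReal.ofReal_pow (by positivity),
          ← ENNReal.ofReal_mul (by positivity), ← ENNReal.ofReal_mul hκ]
        congr 1
        field_simp

/-- The two-sided sequence `τ` shifted `k` steps into the past. -/
def shiftBack {E : Type*} (τ : ℤ → E) (k : ℕ) : ℤ → E := fun m => τ (m - k)

theorem shiftBack_shiftBack {E : Type*} (τ : ℤ → E) (k l : ℕ) :
    shiftBack (shiftBack τ k) l = shiftBack τ (k + l) := by
  funext m
  simp only [shiftBack]
  congr 1
  push_cast
  ring

theorem tailShift_eq_of_agree {E : Type*} {τ τ' : ℤ → E} {n : ℕ}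
    (h : ∀ m : ℤ, -(n : ℤ) ≤ m → τ m = τ' m) : tailShift τ n = tailShift τ' n :=
  funext fun m => h _ (by omega)

theorem tailShift_shiftBack {E : Type*} (τ : ℤ → E) (k l : ℕ) :
    tailShift (shiftBack τ k) l = tailShift τ (k + l) := by
  funext m
  simp only [shiftBack, tailShift]
  congr 1
  push_cast
  ring

theorem Titer_add {E X : Type*} (T : (ℕ → E) → X → X) (τ : ℤ → E) (n m : ℕ) :
    Titer T τ (n + m) = Titer T τ n ∘ Titer T (shiftBack τ n) m := by
  induction m with
  | zero => rfl
  | succ m ih =>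
    change Titer T τ (n + m) ∘ T (tailShift τ (n + m + 1)) =
      Titer T τ n ∘ (Titer T (shiftBack τ n) m ∘ T (tailShift (shiftBack τ n) (m + 1)))
    rw [ih, tailShift_shiftBack]
    rfl

theorem Titer_congr {E X : Type*} (T : (ℕ → E) → X → X) {τ τ' : ℤ → E} {n : ℕ}
    (h : ∀ m : ℤ, -(n : ℤ) ≤ m → τ m = τ' m) : Titer T τ n = Titer T τ' n := by
  induction n with
  | zero => rfl
  | succ n ih =>
    change Titer T τ n ∘ T (tailShift τ (n + 1)) = Titer T τ' n ∘ T (tailShift τ' (n + 1))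
    rw [ih fun m hm => h m (by push_cast; omega), tailShift_eq_of_agree h]

/-- The two-sided sequence with past `p` (read backwards from `-1`) and future `ω`. -/
def joinPast {E : Type*} (p ω : ℕ → E) : ℤ → E
  | Int.ofNat m => ω m
  | Int.negSucc q => p q

/-- A finite word extended by a constant letter. -/
def extendWord {F : Type*} (x₀ : F) {n : ℕ} (w : Fin n → F) : ℕ → F :=
  fun i => if h : i < n then w ⟨i, h⟩ else x₀

theorem extendWord_seqPrefix {F : Type*} (x₀ : F) (ξ : ℕ → F) {k i : ℕ} (hi : i < k) :
    extendWord x₀ (seqPrefix ξ k) i = ξ i := by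
  simp [extendWord, seqPrefix, hi]

theorem joinPast_agree {E : Type*} {p p' ω : ℕ → E} {n : ℕ} (h : ∀ q < n, p q = p' q) {m : ℤ}
    (hm : -(n : ℤ) ≤ m) : joinPast p ω m = joinPast p' ω m := by
  cases m with
  | ofNat m => rfl
  | negSucc q => exact h q (by omega)

theorem joinPast_neg {E : Type*} (p ω : ℕ → E) (q : ℕ) : joinPast p ω (-(q : ℤ) - 1) = p q := by
  have : -(q : ℤ) - 1 = Int.negSucc q := by omega
  rw [this]
  rfl

section Blocks

variable {E : Type*} {n : ℕ} (hn : 0 < n) {F : Finset (Fin n → E)}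

/-- The past obtained by concatenating words of length `n`. -/
def blockPast (ξ : ℕ → F) : ℕ → E := fun q => (ξ (q / n)).1 ⟨q % n, Nat.mod_lt q hn⟩

theorem blockPast_mul_add (ξ : ℕ → F) (k : ℕ) (j : Fin n) :
    blockPast hn ξ (n * k + j) = (ξ k).1 j := by
  have h1 : (n * k + j) / n = k := by
    rw [Nat.mul_add_div hn, Nat.div_eq_of_lt j.2, add_zero]
  have h2 : (n * k + j) % n = j := by
    rw [Nat.mul_add_mod, Nat.mod_eq_of_lt j.2]
  simp only [blockPast, h1, h2]

theorem blockPast_agree {ξ η : ℕ → F} {k : ℕ} (h : ∀ i < k, ξ i = η i) {q : ℕ}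
    (hq : q < n * k) : blockPast hn ξ q = blockPast hn η q := by
  simp only [blockPast, h _ (Nat.div_lt_of_lt_mul hq)]

theorem exists_blockPast_ne {ξ η : ℕ → F} {i : ℕ} (h : ξ i ≠ η i) :
    ∃ q < n * (i + 1), blockPast hn ξ q ≠ blockPast hn η q := by
  by_contra! hc
  refine h (Subtype.ext (funext fun j => ?_))
  have := hc (n * i + j) (by rw [mul_add, mul_one]; have := j.2; omega)
  rwa [blockPast_mul_add, blockPast_mul_add] at this

theorem shiftBack_joinPast_blockPast (x₀ : E) (ω ω' : ℕ → E) (ξ : ℕ → F) (k : ℕ) {m : ℤ}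
    (hm : -(n : ℤ) ≤ m) (hm0 : m < 0) :
    shiftBack (joinPast (blockPast hn ξ) ω) (n * k) m =
      joinPast (extendWord x₀ (ξ k).1) ω' m := by
  obtain ⟨j, rfl⟩ : ∃ j : ℕ, m = -(j : ℤ) - 1 := ⟨(-m - 1).toNat, by omega⟩
  have hj : j < n := by omega
  have he : -(j : ℤ) - 1 - ((n * k : ℕ) : ℤ) = -((n * k + j : ℕ) : ℤ) - 1 := by
    push_cast
    ring
  rw [joinPast_neg, shiftBack, he, joinPast_neg, blockPast_mul_add hn ξ k ⟨j, hj⟩]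
  simp [extendWord, hj]

end Blocks

namespace SmaleSkew

variable {E : Type*} [MeasurableSpace E] (S : SmaleSkew E)

/-- The logarithm of the derivative of the fiber map at the coded point. -/
def logDeriv (τ : ℤ → E) : ℝ := Real.log ‖fderiv ℝ (S.T (truncZ τ)) (S.pi2 τ)‖

/-- Birkhoff sums of `logDeriv` along the past. -/
def logDerivSum (τ : ℤ → E) (n : ℕ) : ℝ :=
  ∑ k ∈ Finset.range n, S.logDeriv (shiftBack τ (k + 1))

theorem logDerivSum_add (τ : ℤ → E) (n m : ℕ) :
    S.logDerivSum τ (n + m) = S.logDerivSum τ n + S.logDerivSum (shiftBack τ n) m := by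
  simp only [logDerivSum, Finset.sum_range_add, shiftBack_shiftBack, add_assoc]

theorem isCompact_Y : IsCompact S.Y := by
  rw [S.hYU]
  exact S.hUbdd.isCompact_closure

theorem U_subset_Y : S.U ⊆ S.Y := S.hYU ▸ subset_closure

theorem U_subset_interior : S.U ⊆ interior S.Y := interior_maximal S.U_subset_Y S.hUopen

theorem lam_pos : 0 < S.lam := one_pos.trans S.hlam

theorem mapsTo_Titer_Y (τ : ℤ → E) (n : ℕ) : MapsTo (Titer S.T τ n) S.Y S.Y := by
  induction n with
  | zero => exact mapsTo_id _
  | succ n ih => exact ih.comp (S.hTY _)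

theorem mapsTo_Titer_Ystar (τ : ℤ → E) (n : ℕ) : MapsTo (Titer S.T τ n) S.Ystar S.Ystar := by
  induction n with
  | zero => exact mapsTo_id _
  | succ n ih => exact ih.comp (S.hTYstar _)

theorem injOn_Titer (τ : ℤ → E) (n : ℕ) : InjOn (Titer S.T τ n) S.Ystar := by
  induction n with
  | zero => exact injOn_id _
  | succ n ih => exact ih.comp (S.hTinj _) (S.hTYstar _)

theorem differentiableAt_Titer (τ : ℤ → E) (n : ℕ) {x : ℂ} (hx : x ∈ S.Ystar) :
    DifferentiableAt ℝ (Titer S.T τ n) x := by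
  induction n generalizing x with
  | zero => exact differentiableAt_id
  | succ n ih => exact (ih (S.hTYstar _ hx)).comp x (S.hTdiff _ x hx)

theorem fderiv_Titer_succ (τ : ℤ → E) (n : ℕ) {x : ℂ} (hx : x ∈ S.Ystar) :
    fderiv ℝ (Titer S.T τ (n + 1)) x =
      (fderiv ℝ (Titer S.T τ n) (S.T (tailShift τ (n + 1)) x)).comp
        (fderiv ℝ (S.T (tailShift τ (n + 1))) x) :=
  fderiv_comp x (S.differentiableAt_Titer τ n (S.hTYstar _ hx)) (S.hTdiff _ x hx)

theorem isConformalMap_fderiv_Titer (τ : ℤ → E) (n : ℕ) {x : ℂ} (hx : x ∈ S.Ystar) :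
    IsConformalMap (fderiv ℝ (Titer S.T τ n) x) := by
  induction n generalizing x with
  | zero =>
    change IsConformalMap (fderiv ℝ id x)
    rw [fderiv_id]
    exact isConformalMap_id
  | succ n ih =>
    rw [S.fderiv_Titer_succ τ n hx]
    exact (ih (S.hTYstar _ hx)).comp (S.hTconf _ x hx)

theorem log_norm_fderiv_Titer_succ (τ : ℤ → E) (n : ℕ) {x : ℂ} (hx : x ∈ S.Ystar) :
    Real.log ‖fderiv ℝ (Titer S.T τ (n + 1)) x‖ =
      Real.log ‖fderiv ℝ (Titer S.T τ n) (S.T (tailShift τ (n + 1)) x)‖ +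
        Real.log ‖fderiv ℝ (S.T (tailShift τ (n + 1))) x‖ := by
  have h1 := S.isConformalMap_fderiv_Titer τ n (S.hTYstar (tailShift τ (n + 1)) hx)
  have h2 := S.hTconf (tailShift τ (n + 1)) x hx
  rw [S.fderiv_Titer_succ τ n hx, h1.norm_comp_eq h2, Real.log_mul h1.norm_pos.ne'
    h2.norm_pos.ne']

theorem dist_Titer_le (τ : ℤ → E) (n : ℕ) {x y : ℂ} (hx : x ∈ S.Ystar) (hy : y ∈ S.Ystar) :
    dist (Titer S.T τ n x) (Titer S.T τ n y) ≤ S.lam⁻¹ ^ n * dist x y := by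
  induction n generalizing x y with
  | zero => simp [Titer]
  | succ n ih =>
    refine (ih (S.hTYstar _ hx) (S.hTYstar _ hy)).trans ?_
    rw [pow_succ, mul_assoc]
    exact mul_le_mul_of_nonneg_left (S.hcontr _ x hx y hy)
      (pow_nonneg (inv_nonneg.2 S.lam_pos.le) n)

theorem isCompact_image_Titer (τ : ℤ → E) (n : ℕ) : IsCompact (Titer S.T τ n '' S.Y) :=
  S.isCompact_Y.image_of_continuousOn fun _ hx =>
    (S.differentiableAt_Titer τ n (S.hYYstar hx)).continuousAt.continuousWithinAt

theorem pi2_mem_Y (τ : ℤ → E) : S.pi2 τ ∈ S.Y := by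
  have h := S.hpi2 τ 1 le_rfl
  rw [(S.isCompact_image_Titer τ 1).isClosed.closure_eq] at h
  exact (S.mapsTo_Titer_Y τ 1).image_subset h

theorem pi2_mem_image (τ : ℤ → E) (n : ℕ) : S.pi2 τ ∈ Titer S.T τ n '' S.Y := by
  rcases n.eq_zero_or_pos with rfl | hn
  · exact ⟨_, S.pi2_mem_Y τ, rfl⟩
  · have h := S.hpi2 τ n hn
    rwa [(S.isCompact_image_Titer τ n).isClosed.closure_eq] at h

theorem Titer_pi2_shiftBack (τ : ℤ → E) (n : ℕ) :
    Titer S.T τ n (S.pi2 (shiftBack τ n)) = S.pi2 τ := by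
  obtain ⟨R, hR⟩ := Metric.isBounded_iff.1 S.isCompact_Y.isBounded
  have hR0 : 0 ≤ R := dist_nonneg.trans (hR (S.pi2_mem_Y τ) (S.pi2_mem_Y τ))
  have hl : S.lam⁻¹ < 1 := inv_lt_one_of_one_lt₀ S.hlam
  have hl0 : 0 ≤ S.lam⁻¹ := inv_nonneg.2 S.lam_pos.le
  have hlim : Tendsto (fun m : ℕ => S.lam⁻¹ ^ m * R) atTop (𝓝 0) := by
    simpa using (tendsto_pow_atTop_nhds_zero_of_lt_one hl0 hl).mul_const R
  refine dist_le_zero.1 (ge_of_tendsto' hlim fun m => ?_)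
  obtain ⟨y, hy, hy'⟩ := S.pi2_mem_image (shiftBack τ n) m
  obtain ⟨z, hz, hz'⟩ := S.pi2_mem_image τ (n + m)
  rw [← hy', ← hz', ← Function.comp_apply (f := Titer S.T τ n), ← Titer_add]
  refine (S.dist_Titer_le τ _ (S.hYYstar hy) (S.hYYstar hz)).trans ?_
  refine mul_le_mul ?_ (hR hy hz) dist_nonneg (pow_nonneg hl0 m)
  exact pow_le_pow_of_le_one hl0 hl.le (Nat.le_add_left m n)

theorem log_norm_fderiv_Titer_pi2 (τ : ℤ → E) (n : ℕ) :
    Real.log ‖fderiv ℝ (Titer S.T τ n) (S.pi2 (shiftBack τ n))‖ = S.logDerivSum τ n := by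
  induction n with
  | zero =>
    change Real.log ‖fderiv ℝ id _‖ = _
    rw [fderiv_id]
    simp [logDerivSum]
  | succ n ih =>
    have h : S.T (tailShift τ (n + 1)) (S.pi2 (shiftBack τ (n + 1))) =
        S.pi2 (shiftBack τ n) := by
      have := S.Titer_pi2_shiftBack (shiftBack τ n) 1
      rw [shiftBack_shiftBack] at this
      rw [← this, ← tailShift_shiftBack τ n 1]
      rfl
    rw [S.log_norm_fderiv_Titer_succ τ n (S.hYYstar (S.pi2_mem_Y _)), h, ih, logDerivSum,
      logDerivSum, Finset.sum_range_succ]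
    rfl

theorem exists_distortion : ∃ B : ℝ, 0 ≤ B ∧ ∀ (τ : ℤ → E) (n : ℕ), ∀ x ∈ S.Ystar,
    |Real.log ‖fderiv ℝ (Titer S.T τ n) x‖ - S.logDerivSum τ n| ≤ B := by
  obtain ⟨α, hα, H, hH, hd⟩ := S.hdistortion
  obtain ⟨R, hR⟩ := Metric.isBounded_iff.1 S.hYstar_bdd
  have hl : S.lam⁻¹ < 1 := inv_lt_one_of_one_lt₀ S.hlam
  have hl0 : 0 ≤ S.lam⁻¹ := inv_nonneg.2 S.lam_pos.le
  set q := S.lam⁻¹ ^ α with hq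
  have hq1 : q < 1 := Real.rpow_lt_one hl0 hl hα
  have hB : 0 < H / (1 - q) := div_pos hH (by linarith)
  have hBq : H / (1 - q) * q + H = H / (1 - q) := by
    have : 1 - q ≠ 0 := by linarith
    field_simp
    ring
  have key : ∀ (τ : ℤ → E) (n : ℕ), ∀ x ∈ S.Ystar, ∀ y ∈ S.Ystar,
      |Real.log ‖fderiv ℝ (Titer S.T τ n) x‖ - Real.log ‖fderiv ℝ (Titer S.T τ n) y‖| ≤
        H / (1 - q) * dist x y ^ α := by
    intro τ n
    induction n with
    | zero =>
      intro x hx y hy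
      change |Real.log ‖fderiv ℝ id _‖ - Real.log ‖fderiv ℝ id _‖| ≤ _
      simp only [fderiv_id, sub_self, abs_zero]
      positivity
    | succ n ih =>
      intro x hx y hy
      rw [S.log_norm_fderiv_Titer_succ τ n hx, S.log_norm_fderiv_Titer_succ τ n hy,
        add_sub_add_comm]
      refine (abs_add_le _ _).trans ?_
      have h1 := ih _ (S.hTYstar (tailShift τ (n + 1)) hx) _
        (S.hTYstar (tailShift τ (n + 1)) hy)
      have h2 := hd (tailShift τ (n + 1)) x hx y hy
      rw [← dist_eq_norm] at h2
      have h3 : dist (S.T (tailShift τ (n + 1)) x) (S.T (tailShift τ (n + 1)) y) ^ α ≤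
          q * dist x y ^ α := by
        rw [hq, ← Real.mul_rpow hl0 dist_nonneg]
        exact Real.rpow_le_rpow dist_nonneg (S.hcontr _ x hx y hy) hα.le
      have h4 := mul_le_mul_of_nonneg_left h3 hB.le
      calc _ ≤ H / (1 - q) * (q * dist x y ^ α) + H * dist x y ^ α := by linarith
        _ = (H / (1 - q) * q + H) * dist x y ^ α := by ring
        _ = _ := by rw [hBq]
  refine ⟨H / (1 - q) * |R| ^ α, by positivity, fun τ n x hx => ?_⟩
  rw [← S.log_norm_fderiv_Titer_pi2]
  have hp := S.hYYstar (S.pi2_mem_Y (shiftBack τ n))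
  refine (key τ n x hx _ hp).trans (mul_le_mul_of_nonneg_left ?_ hB.le)
  exact Real.rpow_le_rpow dist_nonneg ((hR hx hp).trans (le_abs_self R)) hα.le

theorem exists_dist_Titer_le : ∃ C : ℝ, 0 < C ∧ ∀ (τ : ℤ → E) (n : ℕ), ∀ x ∈ S.Y, ∀ y ∈ S.Y,
    dist (Titer S.T τ n x) (Titer S.T τ n y) ≤ C * Real.exp (S.logDerivSum τ n) := by
  obtain ⟨B, -, hB⟩ := S.exists_distortion
  obtain ⟨C, hC, h⟩ := exists_dist_le_of_norm_fderiv_le S.hYstar_open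
    S.hYstar_conn.isPreconnected S.isCompact_Y S.hYYstar
  refine ⟨C * Real.exp B, by positivity, fun τ n x hx y hy => ?_⟩
  rw [mul_assoc, ← Real.exp_add]
  refine h _ _ (fun z hz => S.differentiableAt_Titer τ n hz) (fun z hz => ?_) x hx y hy
  rw [← Real.log_le_iff_le_exp (S.isConformalMap_fderiv_Titer τ n hz).norm_pos]
  linarith [(abs_le.1 (hB τ n z hz)).2]

theorem isOpen_image_T (ω : ℕ → E) {V : Set ℂ} (hV : IsOpen V) (hVY : V ⊆ S.Ystar) :
    IsOpen (S.T ω '' V) := by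
  rw [isOpen_iff_mem_nhds]
  rintro _ ⟨x, hx, rfl⟩
  have hst : HasStrictFDerivAt (S.T ω) (fderiv ℝ (S.T ω) x) x := by
    refine hasStrictFDerivAt_of_hasFDerivAt_of_continuousAt ?_
      ((S.hTC1 ω).continuousAt (S.hYstar_open.mem_nhds (hVY hx)))
    filter_upwards [S.hYstar_open.mem_nhds (hVY hx)] with y hy
    exact (S.hTdiff ω y hy).hasFDerivAt
  obtain ⟨e, he⟩ := (S.hTconf ω x (hVY hx)).exists_equiv
  rw [← he] at hst
  rw [← hst.map_nhds_eq_of_equiv]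
  exact image_mem_map (hV.mem_nhds hx)

theorem isOpen_image_Titer (τ : ℤ → E) (n : ℕ) {V : Set ℂ} (hV : IsOpen V)
    (hVY : V ⊆ S.Ystar) : IsOpen (Titer S.T τ n '' V) := by
  induction n generalizing V with
  | zero => simpa [Titer] using hV
  | succ n ih =>
    change IsOpen ((Titer S.T τ n ∘ S.T (tailShift τ (n + 1))) '' V)
    rw [image_comp]
    refine ih (S.isOpen_image_T _ hV hVY) ?_
    exact (image_mono hVY).trans (S.hTYstar _).image_subset

theorem mapsTo_Titer_interior (τ : ℤ → E) (n : ℕ) :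
    MapsTo (Titer S.T τ n) (interior S.Y) (interior S.Y) := by
  rw [mapsTo_iff_image_subset]
  refine interior_maximal ?_
    (S.isOpen_image_Titer τ n isOpen_interior (interior_subset.trans S.hYYstar))
  exact (image_mono interior_subset).trans (S.mapsTo_Titer_Y τ n).image_subset

theorem exists_le_volume_image_Titer : ∃ c : ℝ, 0 < c ∧ ∀ (τ : ℤ → E) (n : ℕ),
    ENNReal.ofReal (c * Real.exp (S.logDerivSum τ n) ^ 2) ≤
      volume (Titer S.T τ n '' S.U) := by
  obtain ⟨B, -, hB⟩ := S.exists_distortion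
  have hUs : S.U ⊆ S.Ystar := S.U_subset_Y.trans S.hYYstar
  have hfin : volume S.U ≠ ⊤ := S.hUbdd.measure_lt_top.ne
  have hpos : 0 < (volume S.U).toReal :=
    ENNReal.toReal_pos (S.hUopen.measure_pos volume S.hUne).ne' hfin
  refine ⟨Real.exp (-B) ^ 2 * (volume S.U).toReal, by positivity, fun τ n => ?_⟩
  rw [← lintegral_abs_det_fderiv_eq_addHaar_image volume S.hUopen.measurableSet
    (fun x hx => (S.differentiableAt_Titer τ n (hUs hx)).hasFDerivAt.hasFDerivWithinAt)
    ((S.injOn_Titer τ n).mono hUs)]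
  calc _ = ∫⁻ _ in S.U, ENNReal.ofReal (Real.exp (S.logDerivSum τ n - B) ^ 2) := by
        rw [setLIntegral_const, ← ENNReal.ofReal_toReal hfin,
          ← ENNReal.ofReal_mul (by positivity), ENNReal.ofReal_toReal hfin, sub_eq_add_neg,
          Real.exp_add]
        congr 1
        ring
    _ ≤ _ := by
        refine setLIntegral_mono' S.hUopen.measurableSet fun x hx => ?_
        have hc := S.isConformalMap_fderiv_Titer τ n (hUs hx)
        rw [hc.abs_det_eq]
        refine ENNReal.ofReal_le_ofReal (pow_le_pow_left₀ (Real.exp_pos _).le ?_ 2)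
        rw [← Real.le_log_iff_exp_le hc.norm_pos]
        linarith [(abs_le.1 (hB τ n x (hUs hx))).1]

theorem exists_logDerivSum_congr : ∃ K : ℝ, 0 ≤ K ∧ ∀ (n : ℕ) (τ τ' : ℤ → E),
    (∀ m : ℤ, -(n : ℤ) ≤ m → m < 0 → τ m = τ' m) →
      |S.logDerivSum τ n - S.logDerivSum τ' n| ≤ K := by
  obtain ⟨β, hβ, C, hC, h⟩ := S.hHolder
  set q := Real.exp (-β) with hq
  have hq0 : 0 ≤ q := (Real.exp_pos _).le
  have hq1 : q < 1 := by
    rw [hq, ← Real.exp_zero]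
    exact Real.exp_lt_exp.2 (by linarith)
  have hexp : ∀ k : ℕ, Real.exp (-β * k) = q ^ k := fun k => by
    rw [hq, ← Real.exp_nat_mul, mul_comm]
  have hgeo : ∀ n : ℕ, ∑ k ∈ Finset.range n, q ^ k ≤ (1 - q)⁻¹ := fun n => by
    rw [← tsum_geometric_of_lt_one hq0 hq1]
    exact (summable_geometric_of_lt_one hq0 hq1).sum_le_tsum _ fun i _ => pow_nonneg hq0 i
  have hq' : 0 ≤ (1 - q)⁻¹ := inv_nonneg.2 (by linarith)
  refine ⟨C * ((1 - q)⁻¹ + (1 - q)⁻¹), by positivity, fun n τ τ' hτ => ?_⟩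
  rw [logDerivSum, logDerivSum, ← Finset.sum_sub_distrib]
  calc _ ≤ ∑ k ∈ Finset.range n, |S.logDeriv (shiftBack τ (k + 1)) -
          S.logDeriv (shiftBack τ' (k + 1))| := Finset.abs_sum_le_sum_abs _ _
    _ ≤ ∑ k ∈ Finset.range n, C * (q ^ k + q ^ (n - 1 - k)) := by
        refine Finset.sum_le_sum fun k hk => ?_
        have hk' := Finset.mem_range.1 hk
        refine (h _ _ (min k (n - 1 - k)) fun j hj => ?_).trans ?_
        · rw [abs_le] at hj
          refine hτ _ ?_ ?_ <;> push_cast at * <;> omega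
        · rw [hexp]
          refine mul_le_mul_of_nonneg_left ?_ hC.le
          rcases min_choice k (n - 1 - k) with h' | h' <;> rw [h']
          · exact le_add_of_nonneg_right (pow_nonneg hq0 _)
          · exact le_add_of_nonneg_left (pow_nonneg hq0 _)
    _ ≤ _ := by
        rw [← Finset.mul_sum, Finset.sum_add_distrib,
          Finset.sum_range_reflect (fun k => q ^ k) n]
        exact mul_le_mul_of_nonneg_left (add_le_add (hgeo n) (hgeo n)) hC.le

theorem logDeriv_le (τ : ℤ → E) : S.logDeriv τ ≤ -Real.log S.lam := by
  have hp := S.hYYstar (S.pi2_mem_Y τ)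
  rw [logDeriv, ← Real.log_inv]
  refine Real.log_le_log (S.hTconf _ _ hp).norm_pos ?_
  have hl : LipschitzOnWith ⟨S.lam⁻¹, inv_nonneg.2 S.lam_pos.le⟩ (S.T (truncZ τ)) S.Ystar :=
    LipschitzOnWith.of_dist_le_mul fun _ hx _ hy => S.hcontr _ _ hx _ hy
  exact norm_fderiv_le_of_lipschitzOn ℝ (S.hYstar_open.mem_nhds hp) hl

theorem logDerivSum_le (τ : ℤ → E) (n : ℕ) : S.logDerivSum τ n ≤ -(n * Real.log S.lam) := by
  refine (Finset.sum_le_card_nsmul _ _ _ fun k _ => S.logDeriv_le _).trans ?_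
  simp

theorem disjoint_image_Titer {τ τ' : ℤ → E} {i n l : ℕ}
    (h : ∀ m : ℤ, -(i : ℤ) ≤ m → τ m = τ' m) (hne : τ (-(i : ℤ) - 1) ≠ τ' (-(i : ℤ) - 1))
    (hn : i < n) (hl : i < l) : Disjoint (Titer S.T τ n '' S.U) (Titer S.T τ' l '' S.U) := by
  have hcons : ∀ τ : ℤ → E, tailShift τ (i + 1) = cons (τ (-(i : ℤ) - 1)) (tailShift τ i) := by
    intro τ
    funext m
    cases m with
    | zero => simp only [tailShift, cons]; congr 1; push_cast; ring
    | succ m => simp only [tailShift, cons]; congr 1; push_cast; ring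
  have hsub : ∀ (τ : ℤ → E) (n : ℕ), i < n → Titer S.T τ n '' S.U ⊆
      Titer S.T τ i '' (S.T (tailShift τ (i + 1)) '' interior S.Y) := by
    intro τ n hn
    obtain ⟨m, rfl⟩ := Nat.exists_eq_add_of_lt hn
    rw [add_right_comm, Titer_add, image_comp, ← image_comp (Titer S.T τ i)]
    refine image_mono ?_
    exact (image_mono S.U_subset_interior).trans (S.mapsTo_Titer_interior _ m).image_subset
  refine Disjoint.mono (hsub τ n hn) (hsub τ' l hl) ?_
  rw [Titer_congr S.T h]
  have hT : ∀ ω, S.T ω '' interior S.Y ⊆ S.Ystar := fun ω =>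
    (image_mono (interior_subset.trans S.hYYstar)).trans (S.hTYstar ω).image_subset
  rw [disjoint_iff_inter_eq_empty, ← (S.injOn_Titer τ' i).image_inter (hT _) (hT _), hcons,
    hcons, tailShift_eq_of_agree h, S.hOSC _ _ _ hne, image_empty]

/-- The logarithm of the size of the pieces of the limit sets coded by the word `w`. -/
def wordLog (x₀ : E) {n : ℕ} (w : Fin n → E) : ℝ :=
  S.logDerivSum (joinPast (extendWord x₀ w) fun _ => x₀) n

theorem dimH_fiberJ_le [Countable E] (x₀ : E) {s : ℝ≥0}
    (h : ∃ᶠ n in atTop, ∑' w : Fin n → E, ENNReal.ofReal (Real.exp (s * S.wordLog x₀ w)) ≤ 1)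
    (ω : ℕ → E) : dimH (fiberJ S ω) ≤ s := by
  obtain ⟨C, hC, hdiam⟩ := S.exists_dist_Titer_le
  obtain ⟨K, -, hK⟩ := S.exists_logDerivSum_congr
  let P : ∀ n, (Fin n → E) → Set ℂ := fun n w =>
    Titer S.T (joinPast (extendWord x₀ w) ω) n '' S.Y
  have hP : ∀ n w, ediam (P n w) ≤
      ENNReal.ofReal (C * Real.exp (S.logDerivSum (joinPast (extendWord x₀ w) ω) n)) := by
    intro n w
    refine ediam_le ?_
    rintro _ ⟨x, hx, rfl⟩ _ ⟨y, hy, rfl⟩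
    rw [edist_dist]
    exact ENNReal.ofReal_le_ofReal (hdiam _ n x hx y hy)
  have hlog : 0 < Real.log S.lam := Real.log_pos S.hlam
  have hr : Tendsto (fun n : ℕ => ENNReal.ofReal (C * Real.exp (-(n * Real.log S.lam))))
      atTop (𝓝 0) := by
    have h1 : Tendsto (fun n : ℕ => C * Real.exp (-(n * Real.log S.lam))) atTop (𝓝 (C * 0)) :=
      (Real.tendsto_exp_neg_atTop_nhds_zero.comp
        (tendsto_natCast_atTop_atTop.atTop_mul_const hlog)).const_mul C
    simpa using ENNReal.tendsto_ofReal h1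
  have hcov : ∀ n, fiberJ S ω ⊆ ⋃ w, P n w := by
    rintro n _ ⟨τ, hτ, rfl⟩
    refine mem_iUnion.2 ⟨fun i => τ (-((i : ℕ) : ℤ) - 1), ?_⟩
    have := S.pi2_mem_image τ n
    rwa [Titer_congr S.T (τ' := joinPast (extendWord x₀ fun i : Fin n =>
      τ (-((i : ℕ) : ℤ) - 1)) ω)] at this
    intro m hm
    cases m with
    | ofNat m => exact hτ m
    | negSucc q =>
      have hq : q < n := by omega
      simp only [joinPast, extendWord, hq, dite_true]
      congr 1
      omega
  refine dimH_le_of_hausdorffMeasure_ne_top (ne_top_of_le_ne_top (b :=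
    ENNReal.ofReal ((C * Real.exp K) ^ (s : ℝ))) ENNReal.ofReal_ne_top ?_)
  refine (Measure.hausdorffMeasure_le_liminf_tsum s (fiberJ S ω) _ hr P
    (Eventually.of_forall fun n w => (hP n w).trans (ENNReal.ofReal_le_ofReal ?_))
    (Eventually.of_forall hcov)).trans ?_
  · exact mul_le_mul_of_nonneg_left (Real.exp_le_exp.2 (S.logDerivSum_le _ n)) hC.le
  refine liminf_le_of_frequently_le (h.mono fun n hn => ?_)
  calc ∑' w, ediam (P n w) ^ (s : ℝ)
      ≤ ∑' w : Fin n → E, ENNReal.ofReal ((C * Real.exp K) ^ (s : ℝ)) *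
          ENNReal.ofReal (Real.exp (s * S.wordLog x₀ w)) := by
        refine ENNReal.tsum_le_tsum fun w => ?_
        refine (ENNReal.rpow_le_rpow (hP n w) s.2).trans ?_
        rw [← ENNReal.ofReal_mul (by positivity),
          ENNReal.ofReal_rpow_of_nonneg (by positivity) s.2]
        refine ENNReal.ofReal_le_ofReal ?_
        rw [mul_comm (s : ℝ), Real.exp_mul, ← Real.mul_rpow (by positivity) (by positivity)]
        refine Real.rpow_le_rpow (by positivity) ?_ s.2
        rw [mul_assoc, ← Real.exp_add]
        refine mul_le_mul_of_nonneg_left (Real.exp_le_exp.2 ?_) hC.le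
        have := (abs_le.1 (hK n (joinPast (extendWord x₀ w) ω)
          (joinPast (extendWord x₀ w) fun _ => x₀) ?_)).2
        · rw [wordLog]
          linarith
        · intro m _ hm
          cases m with
          | ofNat m => exact absurd hm (by simp)
          | negSucc q => rfl
    _ ≤ ENNReal.ofReal ((C * Real.exp K) ^ (s : ℝ)) * 1 := by
        rw [ENNReal.tsum_mul_left]
        gcongr
    _ = _ := mul_one _

theorem exists_le_dimH_fiberJ [MeasurableSingletonClass E] (x₀ : E) {t : ℝ≥0} (ht : 0 < t) :
    ∃ M : ℝ, ∀ n, 0 < n →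
      ENNReal.ofReal M < ∑' w : Fin n → E, ENNReal.ofReal (Real.exp (t * S.wordLog x₀ w)) →
      ∀ ω : ℕ → E, t ≤ dimH (fiberJ S ω) := by
  obtain ⟨C, hC, hdiam⟩ := S.exists_dist_Titer_le
  obtain ⟨K, hK0, hK⟩ := S.exists_logDerivSum_congr
  obtain ⟨c, hc, hvol⟩ := S.exists_le_volume_image_Titer
  have ht' : (0 : ℝ) < t := ht
  refine ⟨Real.exp (t * K), fun n hn hM ω => ?_⟩
  rw [ENNReal.tsum_eq_iSup_sum, lt_iSup_iff] at hM
  obtain ⟨F, hF⟩ := hM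
  rw [← ENNReal.ofReal_sum_of_nonneg fun _ _ => (Real.exp_pos _).le,
    ENNReal.ofReal_lt_ofReal_iff_of_nonneg (Real.exp_pos _).le] at hF
  set Q := ∑ w ∈ F, Real.exp (t * S.wordLog x₀ w) with hQ
  have hQ0 : 0 < Q := (Real.exp_pos _).trans hF
  have hQK : t * K ≤ Real.log Q := (Real.le_log_iff_exp_le hQ0).2 hF.le
  obtain ⟨d, hd⟩ : F.Nonempty := by
    by_contra h
    rw [Finset.not_nonempty_iff_eq_empty] at h
    simp [hQ, h] at hQ0
  let τ : (ℕ → F) → ℤ → E := fun ξ => joinPast (blockPast hn ξ) ω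
  have hτ : ∀ {ξ η : ℕ → F} {k : ℕ}, (∀ i < k, ξ i = η i) → ∀ m : ℤ,
      -((n * k : ℕ) : ℤ) ≤ m → τ ξ m = τ η m := fun h m hm =>
    joinPast_agree (fun q hq => blockPast_agree hn h hq) hm
  let ex : ∀ k, (Fin k → F) → ℕ → F := fun k w => extendWord ⟨d, hd⟩ w
  have hex : ∀ ξ k, ∀ i < k, ex k (seqPrefix ξ k) i = ξ i := fun ξ k i hi =>
    extendWord_seqPrefix _ ξ hi
  have hTit : ∀ ξ k, Titer S.T (τ (ex k (seqPrefix ξ k))) (n * k) = Titer S.T (τ ξ) (n * k) :=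
    fun ξ k => Titer_congr S.T (hτ (hex ξ k))
  have hblock : ∀ (ξ : ℕ → F) k,
      S.wordLog x₀ (ξ k).1 - K ≤ S.logDerivSum (shiftBack (τ ξ) (n * k)) n := by
    intro ξ k
    have := (abs_le.1 (hK n _ _ fun m hm hm0 =>
      shiftBack_joinPast_blockPast hn x₀ ω (fun _ => x₀) ξ k hm hm0)).1
    rw [wordLog]
    linarith
  have hsum : ∀ (ξ : ℕ → F) k, ∑ i ∈ Finset.range k, (S.wordLog x₀ (ξ i).1 - K) ≤
      S.logDerivSum (τ ξ) (n * k) := by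
    intro ξ k
    induction k with
    | zero => simp [logDerivSum]
    | succ k ih =>
      rw [Finset.sum_range_succ, mul_add, mul_one, logDerivSum_add]
      exact add_le_add ih (hblock ξ k)
  obtain ⟨b, hb⟩ : ∃ b, ∀ i : F, b ≤ S.wordLog x₀ i.1 := by
    obtain ⟨b, hb⟩ := (Set.finite_range fun i : F => S.wordLog x₀ i.1).bddBelow
    exact ⟨b, fun i => hb (mem_range_self i)⟩
  have hlog : 0 < Real.log S.lam := Real.log_pos S.hlam
  have hf : Measurable fun ξ => S.pi2 (τ ξ) := by
    refine S.hpi2_meas.comp (measurable_pi_iff.2 fun m => ?_)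
    cases m with
    | ofNat m => exact measurable_const
    | negSucc q =>
      change Measurable fun ξ : ℕ → F => (ξ (q / n)).1 ⟨q % n, Nat.mod_lt q hn⟩
      exact (measurable_of_countable fun w : F => w.1 ⟨q % n, Nat.mod_lt q hn⟩).comp
        (measurable_pi_apply _)
  have hJ : range (fun ξ => S.pi2 (τ ξ)) ⊆ fiberJ S ω := by
    rintro _ ⟨ξ, rfl⟩
    exact ⟨τ ξ, fun k => rfl, rfl⟩
  refine le_trans ?_ (dimH_mono hJ)
  refine le_dimH_range_of_moran hf
    (p := fun i : F => Real.exp (t * S.wordLog x₀ i.1 - Real.log Q))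
    (fun i => (Real.exp_pos _).le) ?_ ht
    (a := fun k w => Real.exp (S.logDerivSum (τ (ex k w)) (n * k)))
    (fun k w => Real.exp_pos _) ?_ ?_ (c := min c (Real.exp (b - 2 * K)))
    (lt_min hc (Real.exp_pos _)) ?_ ?_
    (V := fun k w => Titer S.T (τ (ex k w)) (n * k) '' S.U) ?_ ?_ hC.le ?_ ?_
  · simp only [Real.exp_sub, Real.exp_log hQ0]
    rw [← Finset.sum_div, Finset.sum_coe_sort F fun w => Real.exp (t * S.wordLog x₀ w), ← hQ,
      div_self hQ0.ne']
  · intro w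
    simp [logDerivSum]
  · intro ξ r hr
    have h1 : Tendsto (fun k : ℕ => Real.exp (-(k * Real.log S.lam))) atTop (𝓝 0) :=
      Real.tendsto_exp_neg_atTop_nhds_zero.comp
        (tendsto_natCast_atTop_atTop.atTop_mul_const hlog)
    obtain ⟨k, hk⟩ := (h1.eventually_le_const hr).exists
    refine ⟨k, le_trans (Real.exp_le_exp.2 ((S.logDerivSum_le _ _).trans ?_)) hk⟩
    have : (k : ℝ) ≤ ((n * k : ℕ) : ℝ) := by
      exact_mod_cast Nat.le_mul_of_pos_left k hn
    exact neg_le_neg (mul_le_mul_of_nonneg_right this hlog.le)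
  · intro ξ k
    refine (mul_le_mul_of_nonneg_right (min_le_right _ _) (Real.exp_pos _).le).trans ?_
    rw [← Real.exp_add, Real.exp_le_exp, mul_add n k, mul_one, logDerivSum_add]
    have h1 := hblock (ex (k + 1) (seqPrefix ξ (k + 1))) k
    have h2 := hb (ex (k + 1) (seqPrefix ξ (k + 1)) k)
    have h3 := (abs_le.1 (hK (n * k) (τ (ex (k + 1) (seqPrefix ξ (k + 1))))
      (τ (ex k (seqPrefix ξ k))) fun m hm _ => hτ (fun i hi => by
        rw [hex ξ k i hi, hex ξ (k + 1) i (by omega)]) m hm)).1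
    linarith
  · intro k w
    rw [← Real.exp_sum, ← Real.exp_mul, Real.exp_le_exp]
    have h1 := hsum (ex k w) k
    rw [Finset.sum_range] at h1
    have hw : ∀ i : Fin k, ex k w i = w i := fun i => by simp [ex, extendWord]
    simp only [hw] at h1
    refine le_trans ?_ (mul_le_mul_of_nonneg_right h1 ht'.le)
    rw [Finset.sum_mul]
    refine Finset.sum_le_sum fun i _ => ?_
    linarith
  · intro k w
    exact (S.isOpen_image_Titer _ _ S.hUopen (S.U_subset_Y.trans S.hYYstar)).measurableSet
  · intro k w
    refine le_trans (ENNReal.ofReal_le_ofReal ?_) (hvol _ _)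
    exact mul_le_mul_of_nonneg_right (min_le_left _ _) (by positivity)
  · rintro ξ k _ ⟨x, hx, rfl⟩
    rw [mem_closedBall, ← S.Titer_pi2_shiftBack (τ ξ) (n * k), ← hTit ξ k]
    exact hdiam _ _ x (S.U_subset_Y hx) _ (S.pi2_mem_Y _)
  · intro ξ η k l i hik hil hne
    classical
    obtain ⟨q, hq, hqne⟩ := exists_blockPast_ne hn hne
    have hfind : ∃ q, blockPast hn ξ q ≠ blockPast hn η q := ⟨q, hqne⟩
    have hlt : Nat.find hfind < n * (i + 1) := (Nat.find_min' hfind hqne).trans_lt hq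
    simp only [hTit]
    refine S.disjoint_image_Titer (i := Nat.find hfind) (fun m hm => ?_) ?_
      (hlt.trans_le (Nat.mul_le_mul_left n hik)) (hlt.trans_le (Nat.mul_le_mul_left n hil))
    · exact joinPast_agree (fun j hj => not_not.1 (Nat.find_min hfind hj)) hm
    · simp only [τ, joinPast_neg]
      exact Nat.find_spec hfind

theorem dimH_fiberJ_le_or_le [Countable E] [MeasurableSingletonClass E] (x₀ : E) {s t : ℝ≥0}
    (ht : 0 < t) (hts : t < s) :
    (∀ ω, dimH (fiberJ S ω) ≤ s) ∨ ∀ ω, t ≤ dimH (fiberJ S ω) := by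
  by_cases h : ∃ᶠ n in atTop,
      ∑' w : Fin n → E, ENNReal.ofReal (Real.exp (s * S.wordLog x₀ w)) ≤ 1
  · exact Or.inl (S.dimH_fiberJ_le x₀ h)
  right
  obtain ⟨M, hM⟩ := S.exists_le_dimH_fiberJ x₀ ht
  have hst : (0 : ℝ) < s - t := sub_pos.2 hts
  have hlog : 0 < Real.log S.lam := Real.log_pos S.hlam
  have hlim : Tendsto (fun n : ℕ => Real.exp (n * ((s - t) * Real.log S.lam))) atTop atTop :=
    Real.tendsto_exp_atTop.comp
      (tendsto_natCast_atTop_atTop.atTop_mul_const (mul_pos hst hlog))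
  obtain ⟨n, h1, h2, hn⟩ := ((not_frequently.1 h).and
    ((hlim.eventually_ge_atTop M).and (eventually_gt_atTop 0))).exists
  refine hM n hn ((ENNReal.ofReal_le_ofReal h2).trans_lt ?_)
  set e := ENNReal.ofReal (Real.exp (n * ((s - t) * Real.log S.lam))) with he
  have he0 : e ≠ 0 := by simp [he, Real.exp_pos]
  calc e = e * 1 := (mul_one _).symm
    _ < e * ∑' w : Fin n → E, ENNReal.ofReal (Real.exp (s * S.wordLog x₀ w)) :=
        ENNReal.mul_lt_mul_right he0 ENNReal.ofReal_ne_top (not_le.1 h1)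
    _ ≤ _ := by
        rw [← ENNReal.tsum_mul_left]
        refine ENNReal.tsum_le_tsum fun w => ?_
        rw [he, ← ENNReal.ofReal_mul (Real.exp_pos _).le, ← Real.exp_add]
        refine ENNReal.ofReal_le_ofReal (Real.exp_le_exp.2 ?_)
        have h3 : S.wordLog x₀ w ≤ -(n * Real.log S.lam) := S.logDerivSum_le _ n
        have h4 := mul_le_mul_of_nonneg_left h3 hst.le
        linarith

theorem dimH_fiberJ_le_dimH_fiberJ [Countable E] [MeasurableSingletonClass E] (ω ω' : ℕ → E) :
    dimH (fiberJ S ω) ≤ dimH (fiberJ S ω') := by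
  by_contra! h
  obtain ⟨t, ht, h1⟩ := ENNReal.lt_iff_exists_nnreal_btwn.1 h
  obtain ⟨s, hs, h2⟩ := ENNReal.lt_iff_exists_nnreal_btwn.1 h1
  have ht0 : 0 < t := by exact_mod_cast zero_le.trans_lt ht
  rcases S.dimH_fiberJ_le_or_le (ω 0) ht0 (by exact_mod_cast hs) with h3 | h3
  · exact absurd (h3 ω) (not_le.2 h2)
  · exact absurd (h3 ω') (not_le.2 ht)

end SmaleSkew

/-- For a conformal Smale skew-product `T` over `I = ℕ* × ℕ*`, the
Hausdorff dimension of the fiber limit set `J_{T,ω}` does not depend on `ω`. -/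
theorem stmt4 (S : SmaleSkew Ialph) :
    ∀ ω ω' : ℕ → Ialph, dimH (fiberJ S ω) = dimH (fiberJ S ω') := by
  intro ω ω'
  exact le_antisymm (S.dimH_fiberJ_le_dimH_fiberJ ω ω') (S.dimH_fiberJ_le_dimH_fiberJ ω' ω)

end
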